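/- Suppose (A1)–(A3) hold. If for some initial value R₀ > 0 there is a solution (σ, R) of the evolutionary tumor problem on [0,∞) with R(0) = R₀ and lim_{t→+∞} R(t) = 0, then S̄ ≤ 0. -/

import Mathlib

open MeasureTheory Set Filter Topology

/-- Heaviside function: `H s = 1` for `s > 0`, `H s = 0` for `s ≤ 0`. -/
noncomputable def Hside (s : ℝ) : ℝ := if 0 < s then 1 else 0

/-- Assumption (A1)/(A2): `f ∈ C¹[0,∞)` is strictly increasing. -/
def C1StrictInc (f : ℝ → ℝ) : Prop :=
  ContDiffOn ℝ 1 f (Ici 0) ∧ StrictMonoOn f (Ici 0)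

/-- Proliferation rate `S`: `S s = g s` if `s > σD`, `S s = -ν` otherwise. -/
noncomputable def Sfun (g : ℝ → ℝ) (σD ν s : ℝ) : ℝ := if σD < s then g s else -ν

/-- A solution of the stationary radial nutrient problem with boundary parameter
`σbar` and radius `R`: `σ` is continuous on `[0,R]`, differentiable on `(0,R]`
with derivative `σ'` there, satisfies
`r² σ'(r) = ∫₀^r l² f(σ l) H(σ l − σD) dl` on `(0,R]` (encoding the ODE together
with `σ'(0) = 0`), and the Robin condition `σ'(R) + β (σ(R) − σbar) = 0`. -/
structure IsStationarySol (f : ℝ → ℝ) (β σD σbar R : ℝ) (σ σ' : ℝ → ℝ) : Prop where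
  cont : ContinuousOn σ (Icc 0 R)
  deriv : ∀ r ∈ Ioc (0:ℝ) R, HasDerivWithinAt σ (σ' r) (Icc 0 R) r
  ode : ∀ r ∈ Ioc (0:ℝ) R,
    r ^ 2 * σ' r = ∫ l in (0:ℝ)..r, l ^ 2 * f (σ l) * Hside (σ l - σD)
  robin : σ' R + β * (σ R - σbar) = 0

/-- A solution of the evolutionary tumor problem on `[0,∞)`: `R` is positive and
differentiable on `[0,∞)` with derivative `R'`, for each `t ≥ 0` the radial profile
`σ(·,t)` solves the stationary problem with parameters `φ t` and `R t`, and
`R(t)² R'(t) = ∫₀^{R(t)} S(σ(r,t)) r² dr` for `t > 0`. -/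
structure IsEvolutionSol (f g : ℝ → ℝ) (β σD ν : ℝ) (φ : ℝ → ℝ)
    (σ : ℝ → ℝ → ℝ) (R R' : ℝ → ℝ) : Prop where
  pos : ∀ t ≥ (0:ℝ), 0 < R t
  stat : ∀ t ≥ (0:ℝ), ∃ σ', IsStationarySol f β σD (φ t) (R t) (fun r => σ r t) σ'
  deriv : ∀ t ≥ (0:ℝ), HasDerivWithinAt R (R' t) (Ici 0) t
  ode : ∀ t > (0:ℝ), (R t) ^ 2 * R' t = ∫ r in (0:ℝ)..(R t), Sfun g σD ν (σ r t) * r ^ 2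

lemma Sfun_mono {g : ℝ → ℝ} {σD ν : ℝ} (hσD : 0 < σD) (hg : StrictMonoOn g (Ici 0))
    (hgν : 0 ≤ g σD + ν) : Monotone (Sfun g σD ν) := by
  intro a b hab
  unfold Sfun
  split_ifs with h1 h2 h2
  · exact hg.monotoneOn (mem_Ici.2 (by linarith)) (mem_Ici.2 (by linarith)) hab
  · exact absurd (lt_of_lt_of_le h1 hab) h2
  · have := hg.monotoneOn (mem_Ici.2 hσD.le) (mem_Ici.2 (by linarith : (0:ℝ) ≤ b)) h2.le
    linarith
  · exact le_rfl

lemma Sfun_lower {g : ℝ → ℝ} {σD ν : ℝ} (hσD : 0 < σD) (hg : StrictMonoOn g (Ici 0))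
    (hgν : 0 ≤ g σD + ν) (s : ℝ) : -ν ≤ Sfun g σD ν s := by
  have h := Sfun_mono hσD hg hgν (min_le_left s σD)
  have h2 : Sfun g σD ν (min s σD) = -ν := by
    unfold Sfun
    rw [if_neg (not_lt.2 (min_le_right _ _))]
  linarith

lemma Sfun_left {g : ℝ → ℝ} {σD ν : ℝ} (hσD : 0 < σD) (hg : ContinuousOn g (Ici 0)) (s : ℝ) :
    Tendsto (fun e : ℝ => Sfun g σD ν (s - e)) (𝓝[>] 0) (𝓝 (Sfun g σD ν s)) := by
  have hs : Tendsto (fun e : ℝ => s - e) (𝓝[>] 0) (𝓝 s) := by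
    have : Tendsto (fun e : ℝ => s - e) (𝓝 0) (𝓝 (s - 0)) := by
      apply Continuous.tendsto; fun_prop
    rw [sub_zero] at this
    exact this.mono_left nhdsWithin_le_nhds
  by_cases h : σD < s
  · have hc : ContinuousAt g s := hg.continuousAt (Ici_mem_nhds (hσD.trans h))
    have h1 : Sfun g σD ν s = g s := if_pos h
    rw [h1]
    refine (hc.tendsto.comp hs).congr' ?_
    filter_upwards [hs.eventually (lt_mem_nhds h)] with e he
    simp [Sfun, he]
  · have h1 : Sfun g σD ν s = -ν := if_neg h
    rw [h1]
    refine tendsto_const_nhds.congr' ?_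
    filter_upwards [self_mem_nhdsWithin] with e he
    have he : 0 < e := he
    have : ¬ σD < s - e := by linarith
    simp [Sfun, this]

lemma stat_bounds {f : ℝ → ℝ} {β σD σbar R B : ℝ} {σ σ' : ℝ → ℝ} (hβ : 0 < β) (hσD : 0 < σD)
    (hR : 0 < R) (hB : σbar ≤ B)
    (hf : StrictMonoOn f (Ici 0)) (hf0 : f 0 = 0)
    (h : IsStationarySol f β σD σbar R σ σ') :
    MonotoneOn σ (Icc 0 R) ∧
      ∀ r ∈ Icc 0 R, σbar - (|f B| * R / β + |f B| * R * R) ≤ σ r := by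
  have hnn : ∀ s, 0 ≤ f s * Hside (s - σD) := by
    intro s
    unfold Hside
    split_ifs with h1
    · have := hf.monotoneOn (mem_Ici.2 le_rfl) (mem_Ici.2 (by linarith : (0:ℝ) ≤ s)) (by linarith)
      linarith
    · simp
  have hd0 : ∀ r ∈ Ioc (0:ℝ) R, 0 ≤ σ' r := by
    intro r hr
    have h1 := h.ode r hr
    have h2 : 0 ≤ ∫ l in (0:ℝ)..r, l ^ 2 * f (σ l) * Hside (σ l - σD) := by
      apply intervalIntegral.integral_nonneg hr.1.le
      intro u hu
      rw [mul_assoc]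
      exact mul_nonneg (sq_nonneg _) (hnn _)
    rw [← h1] at h2
    exact nonneg_of_mul_nonneg_right h2 (pow_pos hr.1 2)
  have hder : ∀ r ∈ interior (Icc (0:ℝ) R), HasDerivAt σ (σ' r) r := by
    intro r hr
    rw [interior_Icc] at hr
    exact (h.deriv r ⟨hr.1, hr.2.le⟩).hasDerivAt (Icc_mem_nhds hr.1 hr.2)
  have hmono : MonotoneOn σ (Icc 0 R) := by
    apply monotoneOn_of_deriv_nonneg (convex_Icc _ _) h.cont
    · intro r hr; exact (hder r hr).differentiableAt.differentiableWithinAt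
    · intro r hr
      rw [(hder r hr).deriv]
      rw [interior_Icc] at hr
      exact hd0 r ⟨hr.1, hr.2.le⟩
  have hRm : R ∈ Icc (0:ℝ) R := ⟨hR.le, le_rfl⟩
  have hσR : σ R ≤ σbar := by
    have h1 := h.robin
    have h2 := hd0 R ⟨hR, le_rfl⟩
    nlinarith
  have hub : ∀ l ∈ Icc 0 R, f (σ l) * Hside (σ l - σD) ≤ |f B| := by
    intro l hl
    have h1 := hmono hl hRm hl.2
    unfold Hside
    split_ifs with h2
    · have := hf.monotoneOn (mem_Ici.2 (by linarith : 0 ≤ σ l))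
        (mem_Ici.2 (by linarith : (0:ℝ) ≤ B)) (by linarith)
      linarith [le_abs_self (f B)]
    · simp
  have hd1 : ∀ r ∈ Ioc (0:ℝ) R, σ' r ≤ |f B| * R := by
    intro r hr
    have h1 := h.ode r hr
    have h2 : ‖∫ l in (0:ℝ)..r, l ^ 2 * f (σ l) * Hside (σ l - σD)‖ ≤ (r ^ 2 * |f B|) * |r - 0| := by
      apply intervalIntegral.norm_integral_le_of_norm_le_const
      intro l hl
      rw [uIoc_of_le hr.1.le] at hl
      rw [mul_assoc, Real.norm_of_nonneg (mul_nonneg (sq_nonneg _) (hnn _))]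
      apply mul_le_mul _ (hub l ⟨hl.1.le, hl.2.trans hr.2⟩) (hnn _) (sq_nonneg _)
      exact pow_le_pow_left₀ hl.1.le hl.2 2
    rw [← h1, sub_zero, abs_of_pos hr.1, mul_assoc] at h2
    have h3 := (le_abs_self _).trans h2
    have h4 := le_of_mul_le_mul_left h3 (pow_pos hr.1 2)
    exact h4.trans (mul_le_mul_of_nonneg_left hr.2 (abs_nonneg _))
  refine ⟨hmono, fun r hr => ?_⟩
  have h1 : σ R - σ r ≤ |f B| * R * (R - r) := by
    apply (convex_Icc (0:ℝ) R).image_sub_le_mul_sub_of_deriv_le h.cont _ _ r hr R hRm hr.2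
    · intro r hr; exact (hder r hr).differentiableAt.differentiableWithinAt
    · intro r hr
      rw [(hder r hr).deriv]
      rw [interior_Icc] at hr
      exact hd1 r ⟨hr.1, hr.2.le⟩
  have h2 : |f B| * R * (R - r) ≤ |f B| * R * R := by
    apply mul_le_mul_of_nonneg_left _ (by positivity)
    linarith [hr.1]
  have h3 : σbar - |f B| * R / β ≤ σ R := by
    have h4 := h.robin
    have h5 := hd1 R ⟨hR, le_rfl⟩
    have h6 : σbar - σ R ≤ |f B| * R / β := by
      rw [le_div_iff₀ hβ]; linarith
    linarith
  linarith

theorem stmt_1 (β σD ν ω : ℝ) (hβ : 0 < β) (hσD : 0 < σD) (hν : 0 < ν) (hω : 0 < ω)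
    (f g : ℝ → ℝ) (hf : C1StrictInc f) (hf0 : f 0 = 0)
    (hg : C1StrictInc g) (hgz : ∃ σt > σD, g σt = 0) (hgν : 0 ≤ g σD + ν)
    (φ : ℝ → ℝ) (hφc : Continuous φ) (hφpos : ∀ t, 0 < φ t)
    (hφper : Function.Periodic φ ω)
    (σ : ℝ → ℝ → ℝ) (R R' : ℝ → ℝ) (R₀ : ℝ) (hR₀ : 0 < R₀) (hinit : R 0 = R₀)
    (hsol : IsEvolutionSol f g β σD ν φ σ R R')
    (hlim : Tendsto R atTop (nhds 0)) :
    (1 / ω) * ∫ t in (0:ℝ)..ω, Sfun g σD ν (φ t) ≤ 0 := by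
  have hSm := Sfun_mono hσD hg.2 hgν
  obtain ⟨B, hB⟩ : ∃ B, ∀ t, φ t ≤ B := by
    obtain ⟨B, hB⟩ := (isCompact_Icc (a := (0:ℝ)) (b := ω)).bddAbove_image hφc.continuousOn
    refine ⟨B, fun t => ?_⟩
    obtain ⟨y, hy, hy2⟩ := hφper.exists_mem_Ico₀ hω t
    rw [hy2]
    exact hB ⟨y, ⟨hy.1, hy.2.le⟩, rfl⟩
  by_contra hcon
  push Not at hcon
  have hpos : 0 < ∫ t in (0:ℝ)..ω, Sfun g σD ν (φ t) :=
    pos_of_mul_pos_right hcon (by positivity)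
  have hmeas : ∀ e : ℝ, Measurable (fun t => Sfun g σD ν (φ t - e)) := fun e =>
    hSm.measurable.comp (hφc.measurable.sub_const e)
  have hbd : ∀ e : ℝ, 0 < e → ∀ t, ‖Sfun g σD ν (φ t - e)‖ ≤ ν + |Sfun g σD ν B| := by
    intro e he t
    rw [Real.norm_eq_abs, abs_le]
    have h1 := Sfun_lower hσD hg.2 hgν (φ t - e)
    have h2 := hSm (by linarith [hB t] : φ t - e ≤ B)
    constructor
    · linarith [abs_nonneg (Sfun g σD ν B)]
    · linarith [le_abs_self (Sfun g σD ν B)]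
  have htend : Tendsto (fun e : ℝ => ∫ t in (0:ℝ)..ω, Sfun g σD ν (φ t - e)) (𝓝[>] 0)
      (𝓝 (∫ t in (0:ℝ)..ω, Sfun g σD ν (φ t))) := by
    apply intervalIntegral.tendsto_integral_filter_of_dominated_convergence
      (fun _ => ν + |Sfun g σD ν B|)
    · exact Eventually.of_forall fun e => (hmeas e).aestronglyMeasurable
    · filter_upwards [self_mem_nhdsWithin] with e he
      exact Eventually.of_forall fun t _ => hbd e he t
    · simp
    · exact Eventually.of_forall fun t _ => Sfun_left hσD hg.1.continuousOn (φ t)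
  obtain ⟨e, hepos, he⟩ := ((htend.eventually (lt_mem_nhds hpos)).and
    self_mem_nhdsWithin).exists.imp fun e h => And.intro h.1 h.2
  have he : 0 < e := he
  have hsmall : Tendsto (fun t => |f B| * R t / β + |f B| * R t * R t) atTop (𝓝 0) := by
    have h1 := ((hlim.const_mul |f B|).div_const β).add ((hlim.const_mul |f B|).mul hlim)
    simpa using h1
  obtain ⟨T, hT⟩ := eventually_atTop.1 ((hsmall.eventually (gt_mem_nhds he)).and
    (eventually_gt_atTop (0:ℝ)))
  have hT0 : 0 < T := (hT T le_rfl).2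
  have hkey : ∀ t ≥ T, Sfun g σD ν (φ t - e) / 3 ≤ R' t / R t := by
    intro t ht
    obtain ⟨h1, h0⟩ := hT t ht
    have hRp := hsol.pos t h0.le
    obtain ⟨σ', hst⟩ := hsol.stat t h0.le
    obtain ⟨hm, hl⟩ := stat_bounds hβ hσD hRp (hB t) hf.2 hf0 hst
    have hode := hsol.ode t h0
    have hint : IntervalIntegrable (fun r => Sfun g σD ν (σ r t) * r ^ 2) volume 0 (R t) := by
      have h2 : MonotoneOn (fun r => Sfun g σD ν (σ r t)) (uIcc 0 (R t)) := by
        rw [uIcc_of_le hRp.le]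
        exact hSm.comp_monotoneOn hm
      exact h2.intervalIntegrable.mul_continuousOn (by fun_prop)
    have h3 : ∫ r in (0:ℝ)..(R t), Sfun g σD ν (φ t - e) * r ^ 2 ≤
        ∫ r in (0:ℝ)..(R t), Sfun g σD ν (σ r t) * r ^ 2 := by
      apply intervalIntegral.integral_mono_on hRp.le _ hint
      · intro r hr
        apply mul_le_mul_of_nonneg_right _ (sq_nonneg r)
        apply hSm
        have := hl r hr
        linarith
      · apply Continuous.intervalIntegrable; fun_prop
    rw [← hode, intervalIntegral.integral_const_mul, integral_pow] at h3
    rw [le_div_iff₀ hRp]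
    have h4 : (R t) ^ 2 * (Sfun g σD ν (φ t - e) / 3 * R t) ≤ (R t) ^ 2 * R' t := by
      refine le_trans (le_of_eq ?_) h3
      push_cast
      ring
    exact le_of_mul_le_mul_left h4 (pow_pos hRp 2)
  have hper : Function.Periodic (fun t => Sfun g σD ν (φ t - e) / 3) ω := by
    intro t
    simp only [hφper t]
  have hstep : ∀ t ≥ T, R t ≤ R (t + ω) := by
    intro t ht
    have h0 : 0 < t := hT0.trans_le ht
    have hderR : ∀ x ≥ t, HasDerivAt R (R' x) x := fun x hx =>
      (hsol.deriv x (by linarith)).hasDerivAt (Ici_mem_nhds (by linarith))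
    have hlog : ∀ x ≥ t, HasDerivAt (fun y => Real.log (R y)) (R' x / R x) x := fun x hx =>
      (hderR x hx).log (hsol.pos x (by linarith)).ne'
    have h1 := intervalIntegral.integral_le_sub_of_hasDeriv_right_of_le
      (a := t) (b := t + ω) (g := fun y => Real.log (R y)) (g' := fun x => R' x / R x)
      (φ := fun t => Sfun g σD ν (φ t - e) / 3) (by linarith)
      (fun x hx => (hlog x hx.1).continuousAt.continuousWithinAt)
      (fun x hx => (hlog x hx.1.le).hasDerivWithinAt)
      (by
        refine Measure.integrableOn_of_bounded (M := (ν + |Sfun g σD ν B|) / 3)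
          (by simp) ((hmeas e).div_const 3).aestronglyMeasurable ?_
        refine Eventually.of_forall fun x => ?_
        rw [norm_div]
        have := hbd e he x
        norm_num at this ⊢
        linarith)
      (fun x hx => hkey x (by linarith [hx.1]))
    rw [hper.intervalIntegral_add_eq t 0, zero_add, intervalIntegral.integral_div] at h1
    have h2 : Real.log (R t) ≤ Real.log (R (t + ω)) := by linarith
    exact (Real.log_le_log_iff (hsol.pos t h0.le) (hsol.pos _ (by linarith))).1 h2
  have hall : ∀ n : ℕ, R T ≤ R (T + n * ω) := by
    intro n
    induction n with
    | zero => simp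
    | succ k ih =>
      have := hstep (T + k * ω) (by nlinarith [(Nat.cast_nonneg k : (0:ℝ) ≤ k)])
      have e1 : T + ((k + 1 : ℕ) : ℝ) * ω = T + k * ω + ω := by push_cast; ring
      rw [e1]
      exact ih.trans this
  have hseq : Tendsto (fun n : ℕ => T + (n:ℝ) * ω) atTop atTop :=
    tendsto_atTop_add_const_left _ _ (tendsto_natCast_atTop_atTop.atTop_mul_const hω)
  have := ge_of_tendsto' (hlim.comp hseq) hall
  linarith [hsol.pos T hT0.le]
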